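/- arXiv:2203.04840 — 2 statements merged into one kernel-verified Lean document; each statement's English description precedes it below -/
import Mathlib

section
/- For every m ∈ ℕ there exists a constant C > 0, depending only on p, s, γ, m, ρ and φ, such that for every real n ≥ 2, every ε > 0 and every multi-index α ∈ ℕ³ with |α| = m, the regularized initial bubble satisfies ‖∂^α v_nᵉ(0, ·)‖_{L²(ℝ³)} ≤ C κ_n n^{m−s} · min(1, 1/(ε n))^{m+3/2}. -/
open MeasureTheory Real ENNReal

noncomputable section

abbrev E3 := EuclideanSpace ℝ (Fin 3)

/-- Partial derivative in the `i`-th coordinate direction. -/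
def pd {F : Type} [NormedAddCommGroup F] [NormedSpace ℝ F] (i : Fin 3) (f : E3 → F) : E3 → F :=
  fun x => fderiv ℝ f x (EuclideanSpace.single i 1)

/-- Iterated partial derivative associated with the multi-index `α : Fin 3 → ℕ`. -/
def pda {F : Type} [NormedAddCommGroup F] [NormedSpace ℝ F] (α : Fin 3 → ℕ) (f : E3 → F) :
    E3 → F :=
  (pd 0)^[α 0] ((pd 1)^[α 1] ((pd 2)^[α 2] f))

/-- The approximate identity `ρ_ε`. -/
def rhoeps (ρ : E3 → ℝ) (ε : ℝ) : E3 → ℝ := fun x => (ε ^ 3)⁻¹ * ρ (ε⁻¹ • x)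

def kap (γ n : ℝ) : ℝ := Real.log n ^ (-γ)

def lam (p : ℕ) (s γ n : ℝ) : ℝ :=
  kap γ n ^ (((p : ℝ) - 1) / 2) * n ^ (((3 : ℝ) / 2 - s) * ((p : ℝ) - 1) / 2)

/-- The bubble `v_n(0,·)`. -/
def bubble (s γ : ℝ) (φ : E3 → ℝ) (n : ℝ) : E3 → ℝ :=
  fun x => kap γ n * n ^ ((3 : ℝ) / 2 - s) * φ (n • x)

/-- Convolution of two real valued functions on `ℝ³`. -/
def convR (f g : E3 → ℝ) : E3 → ℝ :=
  MeasureTheory.convolution f g (ContinuousLinearMap.lsmul ℝ ℝ) volume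

/-- The regularized bubble `v_nᵉ(0,·) = ρ_ε ∗ v_n(0,·)`. -/
def bubbleE (s γ : ℝ) (ρ φ : E3 → ℝ) (n ε : ℝ) : E3 → ℝ :=
  convR (rhoeps ρ ε) (bubble s γ φ n)

/-- The ODE profile `v_nᵉ(t,x) = v_nᵉ(0,x) exp(iσt |v_nᵉ(0,x)|^{p-1})`. -/
def vE (σ : ℝ) (p : ℕ) (s γ : ℝ) (ρ φ : E3 → ℝ) (n ε t : ℝ) : E3 → ℂ :=
  fun x => (bubbleE s γ ρ φ n ε x : ℂ) *
    Complex.exp (Complex.I * σ * t * ((|bubbleE s γ ρ φ n ε x| ^ ((p : ℝ) - 1) : ℝ) : ℂ))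


/-- The dilated convolution `x ↦ ∫ f (x - t y) g y dy`. -/
def dilConv (t : ℝ) (f g : E3 → ℝ) : E3 → ℝ := fun x => ∫ y, f (x - t • y) * g y

lemma pd_iterate_comp_smul (i : Fin 3) (a b : ℝ) (k : ℕ) (f : E3 → ℝ) :
    (pd i)^[k] (fun x => a * f (b • x)) = fun x => a * b ^ k * ((pd i)^[k] f) (b • x) := by
  induction k with
  | zero => simp
  | succ k ih =>
    rw [Function.iterate_succ_apply', ih, Function.iterate_succ_apply']
    funext x
    have h : (fun x => a * b ^ k * ((pd i)^[k] f) (b • x))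
        = (a * b ^ k) • (fun x => ((pd i)^[k] f) (b • x)) := rfl
    rw [pd, h, fderiv_const_smul_field, Pi.smul_apply, fderiv_comp_smul]
    simp only [smul_apply, smul_eq_mul, pd]
    ring

lemma pda_comp_smul (α : Fin 3 → ℕ) (a b : ℝ) (f : E3 → ℝ) :
    pda α (fun x => a * f (b • x)) =
      fun x => a * b ^ (α 0 + α 1 + α 2) * pda α f (b • x) := by
  rw [pda, pd_iterate_comp_smul, pd_iterate_comp_smul, pd_iterate_comp_smul]
  funext x
  rw [pda]
  ring

lemma contDiff_pd (i : Fin 3) {f : E3 → ℝ} (hf : ContDiff ℝ (⊤ : ℕ∞) f) :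
    ContDiff ℝ (⊤ : ℕ∞) (pd i f) :=
  (hf.fderiv_right (m := ((⊤ : ℕ∞) : WithTop ℕ∞)) (by simp)).clm_apply contDiff_const

lemma hasCompactSupport_pd (i : Fin 3) {f : E3 → ℝ} (hf : HasCompactSupport f) :
    HasCompactSupport (pd i f) :=
  hf.fderiv_apply ℝ _

lemma pd_dilConv (i : Fin 3) (t : ℝ) {f g : E3 → ℝ} (hf : ContDiff ℝ (⊤ : ℕ∞) f)
    (hfc : HasCompactSupport f) (hg : Continuous g) (hgc : HasCompactSupport g) :
    pd i (dilConv t f g) = dilConv t (pd i f) g := by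
  funext x
  have hf1 : Differentiable ℝ f := hf.differentiable (by simp)
  have hf' : Continuous (fderiv ℝ f) := hf.continuous_fderiv (by simp)
  obtain ⟨C, hC⟩ := (hfc.fderiv (𝕜 := ℝ)).exists_bound_of_continuous hf'
  have hgi : Integrable g := hg.integrable_of_hasCompactSupport hgc
  have hcont : ∀ x, Continuous fun y => g y • fderiv ℝ f (x - t • y) := fun x => by fun_prop
  have hcs : ∀ x, HasCompactSupport fun y => g y • fderiv ℝ f (x - t • y) :=
    fun x => hgc.smul_right
  have key : HasFDerivAt (dilConv t f g) (∫ y, g y • fderiv ℝ f (x - t • y)) x := by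
    refine hasFDerivAt_integral_of_dominated_of_fderiv_le (F := fun x y => f (x - t • y) * g y)
      (F' := fun x y => g y • fderiv ℝ f (x - t • y)) (bound := fun y => ‖g y‖ * C)
      (s := Set.univ) Filter.univ_mem ?_ ?_ ?_ ?_ ?_ ?_
    · exact .of_forall fun x => Continuous.aestronglyMeasurable (by fun_prop)
    · exact Continuous.integrable_of_hasCompactSupport (by fun_prop) hgc.mul_left
    · exact (hcont x).aestronglyMeasurable
    · refine .of_forall fun y x _ => ?_
      rw [norm_smul]
      gcongr
      exact hC _
    · exact hgi.norm.mul_const C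
    · refine .of_forall fun y x _ => ?_
      have h := (hf1 (x - t • y)).hasFDerivAt.comp x ((hasFDerivAt_id x).sub_const (t • y))
      simpa using h.mul_const (g y)
  rw [pd, key.fderiv, ContinuousLinearMap.integral_apply
    ((hcont x).integrable_of_hasCompactSupport (hcs x))]
  simp only [dilConv, pd, smul_apply, smul_eq_mul, mul_comm]

lemma pd_iterate_dilConv (i : Fin 3) (t : ℝ) (k : ℕ) {f g : E3 → ℝ}
    (hf : ContDiff ℝ (⊤ : ℕ∞) f) (hfc : HasCompactSupport f) (hg : Continuous g)
    (hgc : HasCompactSupport g) :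
    ContDiff ℝ (⊤ : ℕ∞) ((pd i)^[k] f) ∧ HasCompactSupport ((pd i)^[k] f) ∧
      (pd i)^[k] (dilConv t f g) = dilConv t ((pd i)^[k] f) g := by
  induction k with
  | zero => exact ⟨hf, hfc, rfl⟩
  | succ k ih =>
    obtain ⟨h₁, h₂, h₃⟩ := ih
    simp only [Function.iterate_succ_apply']
    exact ⟨contDiff_pd i h₁, hasCompactSupport_pd i h₂, by rw [h₃, pd_dilConv i t h₁ h₂ hg hgc]⟩

lemma pda_dilConv (α : Fin 3 → ℕ) (t : ℝ) {f g : E3 → ℝ}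
    (hf : ContDiff ℝ (⊤ : ℕ∞) f) (hfc : HasCompactSupport f) (hg : Continuous g)
    (hgc : HasCompactSupport g) :
    ContDiff ℝ (⊤ : ℕ∞) (pda α f) ∧ HasCompactSupport (pda α f) ∧
      pda α (dilConv t f g) = dilConv t (pda α f) g := by
  obtain ⟨h₁, h₁c, e₁⟩ := pd_iterate_dilConv 2 t (α 2) hf hfc hg hgc
  obtain ⟨h₂, h₂c, e₂⟩ := pd_iterate_dilConv 1 t (α 1) h₁ h₁c hg hgc
  obtain ⟨h₃, h₃c, e₃⟩ := pd_iterate_dilConv 0 t (α 0) h₂ h₂c hg hgc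
  exact ⟨h₃, h₃c, by rw [pda, e₁, e₂, e₃, pda]⟩

/-- The `L²` norm of a dilated convolution is bounded uniformly in the dilation factor. -/
lemma exists_eLpNorm_dilConv_le {f g : E3 → ℝ} (hf : Continuous f) (hfc : HasCompactSupport f)
    (hg : Continuous g) (hgc : HasCompactSupport g) :
    ∃ C : ℝ, ∀ t : ℝ, |t| ≤ 1 → eLpNorm (dilConv t f g) 2 volume ≤ ENNReal.ofReal C := by
  obtain ⟨A, hA⟩ := hfc.exists_bound_of_continuous hf
  obtain ⟨R, hR⟩ := hfc.isCompact.isBounded.subset_closedBall 0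
  obtain ⟨S, hS⟩ := hgc.isCompact.isBounded.subset_closedBall 0
  have hgi : Integrable g := hg.integrable_of_hasCompactSupport hgc
  set B := Metric.closedBall (0 : E3) (R + S)
  refine ⟨(volume B ^ (2 : ℝ≥0∞).toReal⁻¹ * ENNReal.ofReal (∫ y, A * ‖g y‖)).toReal,
    fun t ht => ?_⟩
  have hsupp : Function.support (dilConv t f g) ⊆ B := by
    intro x hx
    by_contra hxB
    refine hx (integral_eq_zero_of_ae (.of_forall fun y => ?_))
    by_contra hne
    obtain ⟨h₁, h₂⟩ := mul_ne_zero_iff.mp hne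
    have h₁ := mem_closedBall_zero_iff.mp (hR (subset_tsupport _ h₁))
    have h₂ := mem_closedBall_zero_iff.mp (hS (subset_tsupport _ h₂))
    refine hxB (mem_closedBall_zero_iff.mpr ?_)
    calc ‖x‖ = ‖(x - t • y) + t • y‖ := by rw [sub_add_cancel]
      _ ≤ ‖x - t • y‖ + ‖t • y‖ := norm_add_le _ _
      _ ≤ R + 1 * S := by
        rw [norm_smul]
        gcongr
        exact ht
      _ = R + S := by rw [one_mul]
  rw [← eLpNorm_restrict_eq_of_support_subset hsupp, ENNReal.ofReal_toReal]
  · refine (eLpNorm_le_of_ae_bound (C := ∫ y, A * ‖g y‖) (.of_forall fun x => ?_)).trans_eq ?_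
    · refine norm_integral_le_of_norm_le (hgi.norm.const_mul A) (.of_forall fun y => ?_)
      rw [norm_mul]
      gcongr
      exact hA _
    · rw [Measure.restrict_apply_univ]
  · exact ENNReal.mul_ne_top (ENNReal.rpow_ne_top_of_nonneg (by positivity)
      measure_closedBall_lt_top.ne) ENNReal.ofReal_ne_top

/-- Derivatives of order `m` of a dilated convolution are bounded in `L²`, uniformly in the
dilation factor. -/
lemma exists_eLpNorm_pda_dilConv_le {f g : E3 → ℝ} (hf : ContDiff ℝ (⊤ : ℕ∞) f)
    (hfc : HasCompactSupport f) (hg : Continuous g) (hgc : HasCompactSupport g) (m : ℕ) :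
    ∃ C > 0, ∀ t : ℝ, |t| ≤ 1 → ∀ α : Fin 3 → ℕ, α 0 + α 1 + α 2 = m →
      eLpNorm (pda α (dilConv t f g)) 2 volume ≤ ENNReal.ofReal C := by
  have h : ∀ α : Fin 3 → ℕ, ∃ C : ℝ, ∀ t : ℝ, |t| ≤ 1 →
      eLpNorm (pda α (dilConv t f g)) 2 volume ≤ ENNReal.ofReal C := fun α => by
    obtain ⟨h₁, h₂, -⟩ := pda_dilConv α 0 hf hfc hg hgc
    obtain ⟨C, hC⟩ := exists_eLpNorm_dilConv_le h₁.continuous h₂ hg hgc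
    exact ⟨C, fun t ht => by rw [(pda_dilConv α t hf hfc hg hgc).2.2]; exact hC t ht⟩
  choose C hC using h
  obtain ⟨M, hM⟩ := ((Set.finite_Icc (0 : Fin 3 → ℕ) (fun _ => m)).image C).bddAbove
  refine ⟨max M 1, by positivity, fun t ht α hα => (hC α t ht).trans
    (ENNReal.ofReal_le_ofReal ((hM ⟨α, ⟨fun _ => Nat.zero_le _, fun i => ?_⟩, rfl⟩).trans (le_max_left _ _)))⟩
  fin_cases i <;> simp <;> omega

lemma eLpNorm_comp_smul (f : E3 → ℝ) {b : ℝ} (hb : 0 < b) :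
    eLpNorm (fun x => f (b • x)) 2 volume =
      ENNReal.ofReal (b ^ (-(3 / 2) : ℝ)) * eLpNorm f 2 volume := by
  have h := (Homeomorph.smulOfNeZero (α := E3) b hb.ne').measurableEmbedding.eLpNorm_map_measure
    (g := f) (p := 2) (μ := volume)
  have hmap : Measure.map (Homeomorph.smulOfNeZero (α := E3) b hb.ne') volume =
      ENNReal.ofReal |(b ^ Module.finrank ℝ E3)⁻¹| • volume :=
    Measure.map_addHaar_smul (r := b) volume hb.ne'
  rw [hmap, eLpNorm_smul_measure_of_ne_top (by simp)] at h
  refine h.symm.trans ?_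
  rw [smul_eq_mul, ENNReal.ofReal_rpow_of_nonneg (abs_nonneg _) (by positivity)]
  congr 2
  rw [finrank_euclideanSpace_fin, abs_of_pos (by positivity), ← Real.rpow_natCast,
    ← Real.rpow_neg hb.le, ← Real.rpow_mul hb.le]
  norm_num

/-- Scaling of the `L²` norms of the derivatives of a function. -/
lemma eLpNorm_pda_comp_smul (α : Fin 3 → ℕ) {a b : ℝ} (ha : 0 ≤ a) (hb : 0 < b) (f : E3 → ℝ) :
    eLpNorm (pda α (fun x => a * f (b • x))) 2 volume =
      ENNReal.ofReal (a * b ^ (((α 0 + α 1 + α 2 : ℕ) : ℝ) - 3 / 2)) *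
        eLpNorm (pda α f) 2 volume := by
  have h : (fun x => a * b ^ (α 0 + α 1 + α 2) * pda α f (b • x))
      = (a * b ^ (α 0 + α 1 + α 2)) • (fun x => pda α f (b • x)) := rfl
  rw [pda_comp_smul, h, eLpNorm_const_smul, eLpNorm_comp_smul _ hb, ← mul_assoc,
    Real.enorm_of_nonneg (by positivity), ← ENNReal.ofReal_mul (by positivity), mul_assoc,
    sub_eq_add_neg, Real.rpow_add hb, Real.rpow_natCast]

lemma bubbleE_eq_dilConv (s γ : ℝ) (ρ φ : E3 → ℝ) (n : ℝ) {ε : ℝ} (hε : 0 < ε) :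
    bubbleE s γ ρ φ n ε =
      fun x => kap γ n * n ^ ((3 : ℝ) / 2 - s) * dilConv (ε * n) φ ρ (n • x) := by
  funext x
  have h := Measure.integral_comp_inv_smul volume
    (fun z => ρ z * φ (n • x - (ε * n) • z)) ε
  rw [finrank_euclideanSpace_fin, abs_of_pos (by positivity), smul_eq_mul] at h
  have e : ∀ y, n • x - (ε * n) • (ε⁻¹ • y) = n • (x - y) := fun y => by
    rw [smul_smul, smul_sub]
    congr 2
    field_simp
  simp only [e] at h
  have hd : dilConv (ε * n) φ ρ (n • x) = ∫ z, ρ z * φ (n • x - (ε * n) • z) := by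
    simp only [dilConv, mul_comm]
  rw [hd, bubbleE, convR, convolution_lsmul]
  calc ∫ y, rhoeps ρ ε y • bubble s γ φ n (x - y)
      = ∫ y, ((ε ^ 3)⁻¹ * (kap γ n * n ^ ((3 : ℝ) / 2 - s))) *
          (ρ (ε⁻¹ • y) * φ (n • (x - y))) := by
        congr 1
        funext y
        simp only [rhoeps, bubble, smul_eq_mul]
        ring
    _ = _ := by
      rw [integral_const_mul, h]
      field_simp

lemma dilConv_swap {t : ℝ} (ht : 0 < t) (f g : E3 → ℝ) :
    dilConv t f g = fun x => (t ^ 3)⁻¹ * dilConv t⁻¹ g f (t⁻¹ • x) := by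
  funext x
  have h := Measure.integral_comp_smul volume (fun z => f (x - z) * g (t⁻¹ • z)) t
  rw [finrank_euclideanSpace_fin, abs_of_pos (by positivity), smul_eq_mul] at h
  simp only [inv_smul_smul₀ ht.ne'] at h
  rw [dilConv, h, ← integral_sub_left_eq_self _ volume x, dilConv]
  congr 2
  funext y
  rw [show x - (x - y) = y from sub_sub_cancel x y, smul_sub, mul_comm]

/-- `L²` bounds on the derivatives of the regularized initial bubble:
for every `m` there is `C > 0` such that for all `n ≥ 2`, `ε > 0` and every multi-index `α`
with `|α| = m`, `‖∂^α v_nᵉ(0)‖_{L²} ≤ C κ_n n^{m-s} min(1, 1/(εn))^{m+3/2}`. -/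
theorem stmt3
    (σ : ℝ) (hσ : σ = 1 ∨ σ = -1)
    (p : ℕ) (hp_odd : Odd p) (hp : 3 ≤ p)
    (s : ℝ) (hs0 : 0 < s) (hs32 : s < 3 / 2)
    (γ : ℝ) (hγ0 : 0 < γ) (hγ1 : γ < 1)
    (ρ : E3 → ℝ) (hρ_smooth : ContDiff ℝ (⊤ : ℕ∞) ρ) (hρ_supp : HasCompactSupport ρ)
    (hρ_nonneg : ∀ x, 0 ≤ ρ x) (hρ_le : ∀ x, ρ x ≤ 1) (hρ_int : ∫ x, ρ x = 1)
    (φ : E3 → ℝ) (hφ_smooth : ContDiff ℝ (⊤ : ℕ∞) φ)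
    (hφ_supp : tsupport φ ⊆ Metric.closedBall 0 1)
    (hφ_nonneg : ∀ x, 0 ≤ φ x) (hφ_le : ∀ x, φ x ≤ 1)
    (m : ℕ) :
    ∃ C > 0, ∀ n : ℝ, 2 ≤ n → ∀ ε : ℝ, 0 < ε →
      ∀ α : Fin 3 → ℕ, α 0 + α 1 + α 2 = m →
      eLpNorm (pda α (bubbleE s γ ρ φ n ε)) 2 volume ≤
        ENNReal.ofReal (C * kap γ n * n ^ ((m : ℝ) - s) *
          (min 1 (1 / (ε * n))) ^ ((m : ℝ) + 3 / 2)) := by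
  have hφc : HasCompactSupport φ :=
    (isCompact_closedBall 0 1).of_isClosed_subset (isClosed_tsupport φ) hφ_supp
  obtain ⟨C₁, hC₁, h₁⟩ := exists_eLpNorm_pda_dilConv_le hφ_smooth hφc
    hρ_smooth.continuous hρ_supp m
  obtain ⟨C₂, hC₂, h₂⟩ := exists_eLpNorm_pda_dilConv_le hρ_smooth hρ_supp
    hφ_smooth.continuous hφc m
  refine ⟨max C₁ C₂, by positivity, fun n hn ε hε α hα => ?_⟩
  have hn0 : 0 < n := by linarith
  have hκ : 0 ≤ kap γ n := Real.rpow_nonneg (Real.log_nonneg (by linarith)) _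
  have hδ : 0 < ε * n := by positivity
  rw [bubbleE_eq_dilConv s γ ρ φ n hε]
  rcases le_total (ε * n) 1 with hle | hle
  · rw [eLpNorm_pda_comp_smul α (by positivity) hn0, hα,
      min_eq_left ((one_le_div₀ hδ).mpr hle), Real.one_rpow, mul_one]
    refine (mul_le_mul_right (h₁ (ε * n) (by rwa [abs_of_pos hδ]) α hα) _).trans ?_
    rw [← ENNReal.ofReal_mul (by positivity)]
    refine ENNReal.ofReal_le_ofReal ?_
    have e : n ^ ((3 : ℝ) / 2 - s) * n ^ ((m : ℝ) - 3 / 2) = n ^ ((m : ℝ) - s) := by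
      rw [← Real.rpow_add hn0]
      ring_nf
    calc _ = C₁ * kap γ n * (n ^ ((3 : ℝ) / 2 - s) * n ^ ((m : ℝ) - 3 / 2)) := by ring
      _ ≤ _ := by
        rw [e]
        gcongr
        exact le_max_left _ _
  · have hinv : (ε * n)⁻¹ ≤ 1 := inv_le_one_of_one_le₀ hle
    have hfun : (fun x => kap γ n * n ^ ((3 : ℝ) / 2 - s) * dilConv (ε * n) φ ρ (n • x)) =
        fun x => kap γ n * n ^ ((3 : ℝ) / 2 - s) * ((ε * n) ^ 3)⁻¹ *
          dilConv (ε * n)⁻¹ ρ φ (ε⁻¹ • x) := by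
      funext x
      have hx : ε⁻¹ • x = (ε * n)⁻¹ • n • x := by
        rw [smul_smul]
        congr 1
        field_simp
      rw [dilConv_swap hδ, hx, mul_assoc _ (((ε * n) ^ 3)⁻¹)]
    rw [hfun, eLpNorm_pda_comp_smul α (by positivity) (by positivity), hα, one_div,
      min_eq_right hinv]
    refine (mul_le_mul_right (h₂ (ε * n)⁻¹ (by rwa [abs_of_pos (by positivity)]) α hα) _).trans ?_
    rw [← ENNReal.ofReal_mul (by positivity)]
    refine ENNReal.ofReal_le_ofReal ?_
    have e : n ^ ((3 : ℝ) / 2 - s) * ((ε * n) ^ 3)⁻¹ * ε⁻¹ ^ ((m : ℝ) - 3 / 2) =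
        n ^ ((m : ℝ) - s) * (ε * n)⁻¹ ^ ((m : ℝ) + 3 / 2) := by
      rw [← Real.rpow_natCast, Real.inv_rpow hδ.le, Real.inv_rpow hε.le, ← Real.rpow_neg hδ.le,
        ← Real.rpow_neg hδ.le, ← Real.rpow_neg hε.le, Real.mul_rpow hε.le hn0.le,
        Real.mul_rpow hε.le hn0.le]
      calc _ = (n ^ ((3 : ℝ) / 2 - s) * n ^ (-((3 : ℕ) : ℝ))) *
              (ε ^ (-((3 : ℕ) : ℝ)) * ε ^ (-((m : ℝ) - 3 / 2))) := by ring
        _ = (n ^ ((m : ℝ) - s) * n ^ (-((m : ℝ) + 3 / 2))) * ε ^ (-((m : ℝ) + 3 / 2)) := by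
          rw [← Real.rpow_add hn0, ← Real.rpow_add hn0, ← Real.rpow_add hε]
          push_cast
          ring_nf
        _ = _ := by ring
    calc _ = C₂ * kap γ n *
          (n ^ ((3 : ℝ) / 2 - s) * ((ε * n) ^ 3)⁻¹ * ε⁻¹ ^ ((m : ℝ) - 3 / 2)) := by ring
      _ = C₂ * kap γ n * n ^ ((m : ℝ) - s) * (ε * n)⁻¹ ^ ((m : ℝ) + 3 / 2) := by
        rw [e]
        ring
      _ ≤ _ := by
        gcongr
        exact le_max_right _ _
end
end

section
/- Assume φ is not identically zero. Then there exist c > 0 and N ≥ 2 such that for every real n ≥ N and every ε ∈ (0, (100 n)^{−1}], the Laplacian of the regularized bubble at the inflation time t_n satisfies the lower bound ‖Δ v_nᵉ(t_n, ·)‖_{L²(ℝ³)} ≥ c κ_n ((log n)^{(β−γ)(p−1)})² n^{2−s}, where t_n λ_n² = (log n)^{(β−γ)(p−1)}. -/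
open MeasureTheory Real ENNReal

noncomputable section

/-- The inflation time `t_n := λ_n⁻² (log n)^{(β-γ)(p-1)}`. -/
def tinf (p : ℕ) (s γ β n : ℝ) : ℝ :=
  (lam p s γ n ^ 2)⁻¹ * Real.log n ^ ((β - γ) * ((p : ℝ) - 1))

/-- The Laplacian `Δf = ∑ i ∂ᵢ² f` on `ℝ³`. -/
def lap {F : Type} [NormedAddCommGroup F] [NormedSpace ℝ F] (f : E3 → F) : E3 → F :=
  fun x => ∑ i : Fin 3, pd i (pd i f) x

section Calculus

variable {F : Type} [NormedAddCommGroup F] [NormedSpace ℝ F]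

lemma ContDiff.pd {f : E3 → F} (hf : ContDiff ℝ (⊤ : ℕ∞) f) (i : Fin 3) :
    ContDiff ℝ (⊤ : ℕ∞) (pd i f) :=
  (hf.fderiv_right (m := (⊤ : ℕ∞)) (by norm_cast)).clm_apply contDiff_const

lemma ContDiff.lap {f : E3 → F} (hf : ContDiff ℝ (⊤ : ℕ∞) f) :
    ContDiff ℝ (⊤ : ℕ∞) (lap f) :=
  ContDiff.sum fun i _ => (hf.pd i).pd i

lemma tsupport_pd_subset (f : E3 → F) (i : Fin 3) : tsupport (pd i f) ⊆ tsupport f :=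
  (closure_mono fun x (hx : pd i f x ≠ 0) (h : fderiv ℝ f x = 0) => hx (by simp [pd, h])).trans
    (tsupport_fderiv_subset ℝ (f := f))

lemma pd_comp {f : E3 → ℝ} {g : ℝ → F} {g' : F} {x : E3} (i : Fin 3)
    (hg : HasDerivAt g g' (f x)) (hf : DifferentiableAt ℝ f x) :
    pd i (fun y => g (f y)) x = pd i f x • g' := by
  have h := hg.hasFDerivAt.comp x hf.hasFDerivAt
  have h' : pd i (g ∘ f) x = pd i f x • g' := by
    unfold pd
    rw [h.fderiv]
    simp
  exact h'

lemma pd_smul {a : E3 → ℝ} {f : E3 → F} {x : E3} (i : Fin 3)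
    (ha : DifferentiableAt ℝ a x) (hf : DifferentiableAt ℝ f x) :
    pd i (fun y => a y • f y) x = a x • pd i f x + pd i a x • f x := by
  unfold pd
  rw [fderiv_fun_smul ha hf]
  simp

/-- The chain rule for the Laplacian. -/
lemma lap_comp {f : E3 → ℝ} {g g' g'' : ℝ → F} (hf : ContDiff ℝ (⊤ : ℕ∞) f)
    (hg : ∀ r, HasDerivAt g (g' r) r) (hg' : ∀ r, HasDerivAt g' (g'' r) r) (x : E3) :
    lap (fun y => g (f y)) x = lap f x • g' (f x) + (∑ i, pd i f x ^ 2) • g'' (f x) := by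
  have hfd : Differentiable ℝ f := hf.differentiable (by simp)
  unfold lap
  rw [Finset.sum_smul, Finset.sum_smul, ← Finset.sum_add_distrib]
  refine Finset.sum_congr rfl fun i _ => ?_
  have h1 : pd i (fun y => g (f y)) = fun y => pd i f y • g' (f y) :=
    funext fun y => pd_comp i (hg _) (hfd y)
  have hd : DifferentiableAt ℝ (fun y => g' (f y)) x :=
    (hg' (f x)).differentiableAt.comp x (hfd x)
  rw [h1, pd_smul i ((hf.pd i).differentiable (by simp) x) hd, pd_comp i (hg' _) (hfd x),
    smul_smul, ← sq, add_comm]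

end Calculus

section Profile

/-- The pointwise solution profile `r ↦ r exp(i τ r^{k+1})`. -/
def profile (τ : ℝ) (k : ℕ) (r : ℝ) : ℂ :=
  r * Complex.exp (Complex.I * τ * (r : ℂ) ^ (k + 1))

/-- The first derivative of `profile`. -/
def profileD (τ : ℝ) (k : ℕ) (r : ℝ) : ℂ :=
  Complex.exp (Complex.I * τ * (r : ℂ) ^ (k + 1)) *
    (1 + Complex.I * τ * (k + 1) * (r : ℂ) ^ (k + 1))

/-- The second derivative of `profile`. -/
def profileDD (τ : ℝ) (k : ℕ) (r : ℝ) : ℂ :=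
  Complex.exp (Complex.I * τ * (r : ℂ) ^ (k + 1)) *
    (Complex.I * τ * (k + 1) * (k + 2) * (r : ℂ) ^ k
      - ((τ ^ 2 * (k + 1) ^ 2 * r ^ (2 * k + 1) : ℝ) : ℂ))

lemma hasDerivAt_phase (τ : ℝ) (k : ℕ) (r : ℝ) :
    HasDerivAt (fun r : ℝ => Complex.exp (Complex.I * τ * (r : ℂ) ^ (k + 1)))
      (Complex.exp (Complex.I * τ * (r : ℂ) ^ (k + 1)) *
        (Complex.I * τ * ((k + 1) * (r : ℂ) ^ k))) r := by
  have h := ((Complex.ofRealCLM.hasDerivAt (x := r)).pow (k + 1)).const_mul (Complex.I * τ)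
  simpa using h.cexp

lemma hasDerivAt_profile (τ : ℝ) (k : ℕ) (r : ℝ) :
    HasDerivAt (profile τ k) (profileD τ k r) r := by
  have h := (Complex.ofRealCLM.hasDerivAt (x := r)).mul (hasDerivAt_phase τ k r)
  refine h.congr_deriv ?_
  simp only [profileD, Complex.ofRealCLM_apply, Complex.ofReal_one]
  ring

lemma hasDerivAt_profileD (τ : ℝ) (k : ℕ) (r : ℝ) :
    HasDerivAt (profileD τ k) (profileDD τ k r) r := by
  have h1 := (((Complex.ofRealCLM.hasDerivAt (x := r)).pow (k + 1)).const_mul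
    (Complex.I * τ * (k + 1))).const_add 1
  have h := (hasDerivAt_phase τ k r).mul h1
  refine h.congr_deriv ?_
  simp only [profileDD, Complex.ofRealCLM_apply, Complex.ofReal_one, Pi.pow_apply]
  push_cast
  linear_combination (Complex.exp (Complex.I * τ * (r : ℂ) ^ (k + 1)) * τ ^ 2 * (k + 1) ^ 2 *
    (r : ℂ) ^ (2 * k + 1)) * Complex.I_sq

lemma contDiff_profile (τ : ℝ) (k : ℕ) : ContDiff ℝ (⊤ : ℕ∞) (profile τ k) := by
  have h : ContDiff ℝ (⊤ : ℕ∞) (fun r : ℝ => (r : ℂ)) := Complex.ofRealCLM.contDiff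
  exact h.mul (contDiff_const.mul (h.pow _)).cexp

lemma norm_phase (τ : ℝ) (k : ℕ) (r : ℝ) :
    ‖Complex.exp (Complex.I * τ * (r : ℂ) ^ (k + 1))‖ = 1 := by
  have : Complex.I * τ * (r : ℂ) ^ (k + 1) = ((τ * r ^ (k + 1) : ℝ) : ℂ) * Complex.I := by
    push_cast; ring
  rw [this, Complex.norm_exp_ofReal_mul_I]

lemma norm_profile_combination_ge (τ : ℝ) (k : ℕ) (r D G : ℝ) :
    τ ^ 2 * (k + 1) ^ 2 * r ^ (2 * k + 1) * G - D ≤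
      ‖D • profileD τ k r + G • profileDD τ k r‖ := by
  set z : ℂ := D * (1 + Complex.I * τ * (k + 1) * (r : ℂ) ^ (k + 1)) +
    G * (Complex.I * τ * (k + 1) * (k + 2) * (r : ℂ) ^ k
      - ((τ ^ 2 * (k + 1) ^ 2 * r ^ (2 * k + 1) : ℝ) : ℂ)) with hz
  have h1 : D • profileD τ k r + G • profileDD τ k r =
      Complex.exp (Complex.I * τ * (r : ℂ) ^ (k + 1)) * z := by
    simp only [profileD, profileDD, Complex.real_smul, hz]
    ring
  have h2 : z = ((D - τ ^ 2 * (k + 1) ^ 2 * r ^ (2 * k + 1) * G : ℝ) : ℂ) +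
      ((D * (τ * (k + 1) * r ^ (k + 1)) + G * (τ * (k + 1) * (k + 2) * r ^ k) : ℝ) : ℂ) *
        Complex.I := by
    rw [hz]; push_cast; ring
  have h3 : z.re = D - τ ^ 2 * (k + 1) ^ 2 * r ^ (2 * k + 1) * G := by
    rw [h2, Complex.add_re, Complex.re_ofReal_mul, Complex.I_re, Complex.ofReal_re]; ring
  rw [h1, norm_mul, norm_phase, one_mul]
  have := (abs_le.1 (Complex.abs_re_le_norm z)).1
  linarith

/-- The real part of the rotated Laplacian only retains the quadratic term in `τ`. -/
lemma norm_lap_profile_ge {f : E3 → ℝ} (hf : ContDiff ℝ (⊤ : ℕ∞) f) (hf0 : ∀ x, 0 ≤ f x)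
    (τ : ℝ) (k : ℕ) (x : E3) :
    τ ^ 2 * (k + 1) ^ 2 * (f x ^ (2 * k + 1) * pd 0 f x ^ 2) - lap f x ≤
      ‖lap (fun y => profile τ k (f y)) x‖ := by
  rw [lap_comp hf (hasDerivAt_profile τ k) (hasDerivAt_profileD τ k)]
  refine le_trans ?_ (norm_profile_combination_ge τ k (f x) _ _)
  have h : pd 0 f x ^ 2 ≤ ∑ i, pd i f x ^ 2 :=
    Finset.single_le_sum (f := fun i => pd i f x ^ 2) (fun i _ => sq_nonneg _)
      (Finset.mem_univ 0)
  have h0 : 0 ≤ τ ^ 2 * (k + 1) ^ 2 * f x ^ (2 * k + 1) := by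
    have := hf0 x
    positivity
  have := mul_le_mul_of_nonneg_left h h0
  linarith

end Profile

section Integrals

open Metric

lemma integrableOn_closedBall {f : E3 → ℝ} (hf : Continuous f) (r : ℝ) :
    IntegrableOn f (closedBall 0 r) :=
  hf.continuousOn.integrableOn_compact (isCompact_closedBall 0 r)

lemma setIntegral_closedBall_eq {f : E3 → ℝ} {r : ℝ} (hsupp : tsupport f ⊆ closedBall 0 r) :
    ∫ x in closedBall 0 r, f x = ∫ x, f x :=
  setIntegral_eq_integral_of_forall_compl_eq_zero fun _ hx =>
    image_eq_zero_of_notMem_tsupport fun h => hx (hsupp h)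

lemma hasCompactSupport_of_subset_closedBall {F : Type*} [Zero F] {f : E3 → F} {r : ℝ}
    (hsupp : tsupport f ⊆ closedBall 0 r) : HasCompactSupport f :=
  (isCompact_closedBall 0 r).of_isClosed_subset (isClosed_tsupport f) hsupp

lemma integral_pd_eq_zero {f : E3 → ℝ} (hf : ContDiff ℝ (⊤ : ℕ∞) f)
    (hc : HasCompactSupport f) (i : Fin 3) : ∫ x, pd i f x = 0 := by
  have hd : HasCompactSupport (pd i f) := hc.mono' (subset_closure.trans (tsupport_pd_subset f i))
  have h := integral_mul_fderiv_eq_neg_fderiv_mul_of_integrable (μ := (volume : Measure E3))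
    (𝕜 := ℝ) (f := fun _ => (1 : ℝ)) (g := f) (v := EuclideanSpace.single i 1)
    (by simp)
    (by simpa [pd] using! (hf.pd i).continuous.integrable_of_hasCompactSupport (μ := volume) hd)
    (by simpa using hf.continuous.integrable_of_hasCompactSupport hc)
    (fun x _ => differentiableAt_const _) (fun x _ => hf.differentiable (by simp) x)
  simpa [pd] using h

lemma integral_lap_eq_zero {f : E3 → ℝ} (hf : ContDiff ℝ (⊤ : ℕ∞) f)
    (hc : HasCompactSupport f) : ∫ x, lap f x = 0 := by
  have hd (i : Fin 3) : HasCompactSupport (pd i f) :=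
    hc.mono' (subset_closure.trans (tsupport_pd_subset f i))
  have hdd (i : Fin 3) : HasCompactSupport (pd i (pd i f)) :=
    (hd i).mono' (subset_closure.trans (tsupport_pd_subset _ i))
  unfold lap
  rw [integral_finsetSum _ fun i _ =>
    ((hf.pd i).pd i).continuous.integrable_of_hasCompactSupport (hdd i)]
  exact Finset.sum_eq_zero fun i _ => integral_pd_eq_zero (hf.pd i) (hd i) i

/-- Integrating by parts against the coordinate `x₀` bounds the mass of `f` by that of `∂₀ f`. -/
lemma integral_le_mul_setIntegral_abs_pd {f : E3 → ℝ} {r : ℝ} (hf : ContDiff ℝ (⊤ : ℕ∞) f)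
    (hsupp : tsupport f ⊆ closedBall 0 r) :
    ∫ x, f x ≤ r * ∫ x in closedBall 0 r, |pd 0 f x| := by
  have hc := hasCompactSupport_of_subset_closedBall hsupp
  have hd : HasCompactSupport (pd 0 f) := hc.mono' (subset_closure.trans (tsupport_pd_subset f 0))
  have hx : ContDiff ℝ (⊤ : ℕ∞) (fun x : E3 => x 0) := by fun_prop
  have hpx (x : E3) : fderiv ℝ (fun x : E3 => x 0) x (EuclideanSpace.single 0 1) = 1 := by
    have : HasFDerivAt (fun x : E3 => x 0) (EuclideanSpace.proj (𝕜 := ℝ) (0 : Fin 3)) x :=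
      (EuclideanSpace.proj (𝕜 := ℝ) (0 : Fin 3)).hasFDerivAt
    rw [this.fderiv]
    simp
  have h := integral_mul_fderiv_eq_neg_fderiv_mul_of_integrable (μ := (volume : Measure E3))
    (𝕜 := ℝ) (f := fun x : E3 => x 0) (g := f) (v := EuclideanSpace.single 0 1)
    (by simpa [hpx] using hf.continuous.integrable_of_hasCompactSupport hc)
    ((hx.continuous.mul (hf.pd 0).continuous).integrable_of_hasCompactSupport hd.mul_left)
    ((hx.continuous.mul hf.continuous).integrable_of_hasCompactSupport hc.mul_left)
    (fun x _ => hx.differentiable (by simp) x) (fun x _ => hf.differentiable (by simp) x)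
  simp only [hpx, one_mul] at h
  have h2 : ∫ x, f x = ∫ x in closedBall 0 r, -(x 0 * pd 0 f x) := by
    rw [setIntegral_eq_integral_of_forall_compl_eq_zero, integral_neg]
    · unfold pd; linarith
    · intro x hxr
      have : pd 0 f x = 0 := image_eq_zero_of_notMem_tsupport fun h =>
        hxr (hsupp (tsupport_pd_subset f 0 h))
      simp [this]
  rw [h2, ← integral_const_mul]
  refine setIntegral_mono_on
    (integrableOn_closedBall (hx.continuous.mul (hf.pd 0).continuous).neg r)
    (integrableOn_closedBall (continuous_const.mul (hf.pd 0).continuous.abs) r)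
    measurableSet_closedBall fun x hxr => ?_
  have hx0 : |x 0| ≤ r :=
    (PiLp.norm_apply_le x 0).trans (by simpa using hxr)
  calc -(x 0 * pd 0 f x) ≤ |x 0 * pd 0 f x| := neg_le_abs _
    _ = |x 0| * |pd 0 f x| := abs_mul _ _
    _ ≤ r * |pd 0 f x| := by gcongr

lemma sq_setIntegral_le {h : E3 → ℝ} (hh : Continuous h) (r : ℝ) :
    (∫ x in closedBall 0 r, h x) ^ 2 ≤
      volume.real (closedBall (0 : E3) r) * ∫ x in closedBall 0 r, h x ^ 2 := by
  set V := volume.real (closedBall (0 : E3) r) with hV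
  set H := ∫ x in closedBall 0 r, h x with hH
  set I := ∫ x in closedBall 0 r, h x ^ 2 with hI
  have hV0 : 0 ≤ V := measureReal_nonneg
  have i1 := integrableOn_closedBall hh r
  have i2 : IntegrableOn (fun x => h x ^ 2) (closedBall 0 r) :=
    integrableOn_closedBall (hh.pow 2) r
  have h0 : 0 ≤ ∫ x in closedBall 0 r, (V * h x - H) ^ 2 := integral_nonneg fun x => sq_nonneg _
  have h1 : ∫ x in closedBall 0 r, (V * h x - H) ^ 2 = V ^ 2 * I - 2 * V * H * H + V * H ^ 2 := by
    have : (fun x => (V * h x - H) ^ 2) =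
        fun x => V ^ 2 * h x ^ 2 - 2 * V * H * h x + H ^ 2 := by ext; ring
    have i3 : IntegrableOn (fun x => V ^ 2 * h x ^ 2 - 2 * V * H * h x) (closedBall 0 r) :=
      (i2.const_mul _).sub (i1.const_mul _)
    rw [this, integral_add i3 (integrableOn_closedBall continuous_const r),
      integral_sub (i2.const_mul _) (i1.const_mul _), integral_const_mul, integral_const_mul, setIntegral_const, smul_eq_mul]
  rcases hV0.eq_or_lt with hz | hpos
  · have : H = 0 := by
      rw [hH]
      refine setIntegral_measure_zero _ ?_
      exact (measureReal_eq_zero_iff measure_closedBall_lt_top.ne).1 hz.symm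
    rw [this, ← hz]; simp
  · rw [h1] at h0
    have : 0 ≤ V * (V * I - H ^ 2) := by linarith
    have := nonneg_of_mul_nonneg_right this hpos
    linarith

/-- A lower bound for the mass of a power of a nonnegative function on a ball. -/
lemma mul_le_setIntegral_pow {f : E3 → ℝ} (hf : Continuous f) (hf0 : ∀ x, 0 ≤ f x)
    {a : ℝ} (ha : 0 ≤ a) (r : ℝ) (m : ℕ) :
    a ^ m * ((∫ x in closedBall 0 r, f x) - a * volume.real (closedBall (0 : E3) r)) ≤
      ∫ x in closedBall 0 r, f x ^ (m + 1) := by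
  have i1 := integrableOn_closedBall hf r
  have : a ^ m * ((∫ x in closedBall 0 r, f x) - a * volume.real (closedBall (0 : E3) r)) =
      ∫ x in closedBall 0 r, a ^ m * (f x - a) := by
    rw [integral_const_mul, integral_sub i1 (integrableOn_closedBall continuous_const r),
      setIntegral_const, smul_eq_mul, mul_comm a]
  rw [this]
  refine integral_mono ((i1.sub (integrableOn_closedBall continuous_const r)).const_mul _)
    (integrableOn_closedBall (hf.pow _) r) fun x => ?_
  have hx := hf0 x
  show a ^ m * (f x - a) ≤ f x ^ (m + 1)
  rcases le_total a (f x) with h | h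
  · calc a ^ m * (f x - a) ≤ f x ^ m * f x := by gcongr; linarith
      _ = _ := by ring
  · calc a ^ m * (f x - a) ≤ 0 := mul_nonpos_of_nonneg_of_nonpos (by positivity) (by linarith)
      _ ≤ _ := by positivity

/-- Quantitative nondegeneracy of the weighted Dirichlet energy of a bump function. -/
lemma sq_mul_le_setIntegral_weighted_energy {f : E3 → ℝ} {r A a : ℝ} (k : ℕ)
    (hf : ContDiff ℝ (⊤ : ℕ∞) f) (hsupp : tsupport f ⊆ closedBall 0 r) (hf0 : ∀ x, 0 ≤ f x)
    (hfA : ∀ x, f x ≤ A) (ha : 0 ≤ a)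
    (haV : a * volume.real (closedBall (0 : E3) r) ≤ ∫ x, f x) :
    (a ^ (k + 1) * ((∫ x, f x) - a * volume.real (closedBall (0 : E3) r))) ^ 2 ≤
      (r * (k + 2)) ^ 2 * volume.real (closedBall (0 : E3) r) * A *
        ∫ x in closedBall 0 r, f x ^ (2 * k + 1) * pd 0 f x ^ 2 := by
  set V := volume.real (closedBall (0 : E3) r) with hV
  have hV0 : 0 ≤ V := measureReal_nonneg
  set h : E3 → ℝ := fun x => f x ^ (k + 1) * |pd 0 f x| with hh
  have hhc : Continuous h := (hf.continuous.pow _).mul (hf.pd 0).continuous.abs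
  have hpsupp : tsupport (fun x => f x ^ (k + 2)) ⊆ closedBall 0 r :=
    (closure_mono fun x (hx : f x ^ (k + 2) ≠ 0) (h : f x = 0) => hx (by simp [h])).trans hsupp
  have hpd : ∀ x, |pd 0 (fun y => f y ^ (k + 2)) x| = (k + 2) * h x := by
    intro x
    have h1 := pd_comp (g := fun y : ℝ => y ^ (k + 2)) 0 (hasDerivAt_pow (k + 2) (f x))
      (hf.differentiable (by simp) x)
    have h2 : 0 ≤ ((k + 2 : ℕ) : ℝ) * f x ^ (k + 2 - 1) := by have := hf0 x; positivity
    rw [h1, smul_eq_mul, abs_mul, abs_of_nonneg h2, hh, show k + 2 - 1 = k + 1 from rfl]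
    push_cast
    ring
  have s1 := mul_le_setIntegral_pow hf.continuous hf0 ha r (k + 1)
  have s2 := integral_le_mul_setIntegral_abs_pd (hf.pow (k + 2)) hpsupp
  rw [← setIntegral_closedBall_eq hpsupp] at s2
  simp only [hpd] at s2
  rw [integral_const_mul] at s2
  rw [setIntegral_closedBall_eq hsupp] at s1
  have s3 := sq_setIntegral_le hhc r
  have s4 : ∫ x in closedBall 0 r, h x ^ 2 ≤
      A * ∫ x in closedBall 0 r, f x ^ (2 * k + 1) * pd 0 f x ^ 2 := by
    rw [← integral_const_mul]
    have hc2 : Continuous fun x => f x ^ (2 * k + 1) * pd 0 f x ^ 2 :=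
      (hf.continuous.pow _).mul ((hf.pd 0).continuous.pow _)
    refine integral_mono (integrableOn_closedBall (hhc.pow 2) r)
      ((integrableOn_closedBall hc2 r).const_mul A) fun x => ?_
    have := hf0 x
    calc h x ^ 2 = f x * (f x ^ (2 * k + 1) * pd 0 f x ^ 2) := by
          simp only [hh, mul_pow, sq_abs]; ring
      _ ≤ A * (f x ^ (2 * k + 1) * pd 0 f x ^ 2) := by
          gcongr
          exact hfA x
  calc (a ^ (k + 1) * ((∫ x, f x) - a * V)) ^ 2
      ≤ (r * ((k + 2) * ∫ x in closedBall 0 r, h x)) ^ 2 := by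
        refine pow_le_pow_left₀ (mul_nonneg (by positivity) (by linarith)) (s1.trans s2) 2
    _ = (r * (k + 2)) ^ 2 * (∫ x in closedBall 0 r, h x) ^ 2 := by ring
    _ ≤ (r * (k + 2)) ^ 2 * (V *
          (A * ∫ x in closedBall 0 r, f x ^ (2 * k + 1) * pd 0 f x ^ 2)) := by
        gcongr
        exact s3.trans (by gcongr)
    _ = _ := by ring

lemma ofReal_setIntegral_norm_le_eLpNorm_two {u : E3 → ℂ} (hu : Continuous u) (r : ℝ) :
    ENNReal.ofReal (∫ x in closedBall 0 r, ‖u x‖) ≤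
      ENNReal.ofReal (√(volume.real (closedBall (0 : E3) r))) * eLpNorm u 2 volume := by
  have hi : IntegrableOn u (closedBall 0 r) :=
    hu.continuousOn.integrableOn_compact (isCompact_closedBall 0 r)
  rw [ofReal_integral_norm_eq_lintegral_enorm hi, ← eLpNorm_one_eq_lintegral_enorm]
  refine (eLpNorm_le_eLpNorm_mul_rpow_measure_univ (p := 1) (q := 2) (by norm_num)
    hu.aestronglyMeasurable.restrict).trans ?_
  rw [mul_comm]
  gcongr
  · rw [Measure.restrict_apply_univ, Real.sqrt_eq_rpow, ← ENNReal.ofReal_rpow_of_nonneg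
      measureReal_nonneg (by norm_num), ofReal_measureReal measure_closedBall_lt_top.ne]
    norm_num
  · exact Measure.restrict_le_self

/-- A lower bound for the Laplacian of the profile evaluated on a bump function. -/
lemma le_mul_eLpNorm_lap_profile {f : E3 → ℝ} {r A a : ℝ} (τ : ℝ) (k : ℕ)
    (hf : ContDiff ℝ (⊤ : ℕ∞) f) (hsupp : tsupport f ⊆ closedBall 0 r) (hf0 : ∀ x, 0 ≤ f x)
    (hfA : ∀ x, f x ≤ A) (ha : 0 ≤ a)
    (haV : a * volume.real (closedBall (0 : E3) r) ≤ ∫ x, f x) :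
    ENNReal.ofReal (τ ^ 2 * (k + 1) ^ 2 *
      (a ^ (k + 1) * ((∫ x, f x) - a * volume.real (closedBall (0 : E3) r))) ^ 2) ≤
      ENNReal.ofReal ((r * (k + 2)) ^ 2 * volume.real (closedBall (0 : E3) r) * A *
        √(volume.real (closedBall (0 : E3) r))) *
        eLpNorm (lap fun x => profile τ k (f x)) 2 volume := by
  set V := volume.real (closedBall (0 : E3) r) with hV
  have hV0 : 0 ≤ V := measureReal_nonneg
  have hA0 : 0 ≤ A := (hf0 0).trans (hfA 0)
  have hu : Continuous (lap fun x => profile τ k (f x)) :=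
    ((contDiff_profile τ k).comp hf).lap.continuous
  have hc2 : Continuous fun x => f x ^ (2 * k + 1) * pd 0 f x ^ 2 :=
    (hf.continuous.pow _).mul ((hf.pd 0).continuous.pow _)
  have hlapsupp : tsupport (lap f) ⊆ closedBall 0 r := by
    refine closure_minimal (fun x hx => ?_) isClosed_closedBall
    by_contra h
    refine hx (Finset.sum_eq_zero fun i _ => image_eq_zero_of_notMem_tsupport fun h' => h ?_)
    exact hsupp (tsupport_pd_subset f i (tsupport_pd_subset _ i h'))
  set J := ∫ x in closedBall 0 r, f x ^ (2 * k + 1) * pd 0 f x ^ 2 with hJ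
  have h1 : τ ^ 2 * (k + 1) ^ 2 * J ≤
      ∫ x in closedBall 0 r, ‖lap (fun x => profile τ k (f x)) x‖ := by
    have : τ ^ 2 * (k + 1) ^ 2 * J = ∫ x in closedBall 0 r,
        (τ ^ 2 * (k + 1) ^ 2 * (f x ^ (2 * k + 1) * pd 0 f x ^ 2) - lap f x) := by
      rw [integral_sub ((integrableOn_closedBall hc2 r).const_mul _)
        (integrableOn_closedBall hf.lap.continuous r), integral_const_mul,
        setIntegral_closedBall_eq hlapsupp,
        integral_lap_eq_zero hf (hasCompactSupport_of_subset_closedBall hsupp), sub_zero]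
    rw [this]
    exact integral_mono (((integrableOn_closedBall hc2 r).const_mul _).sub
        (integrableOn_closedBall hf.lap.continuous r))
      (integrableOn_closedBall hu.norm r) fun x => norm_lap_profile_ge hf hf0 τ k x
  have h2 := sq_mul_le_setIntegral_weighted_energy k hf hsupp hf0 hfA ha haV
  calc _ ≤ ENNReal.ofReal ((r * (k + 2)) ^ 2 * V * A *
        ∫ x in closedBall 0 r, ‖lap (fun x => profile τ k (f x)) x‖) := by
        refine ENNReal.ofReal_le_ofReal ?_
        calc _ ≤ τ ^ 2 * (k + 1) ^ 2 * ((r * (k + 2)) ^ 2 * V * A * J) := by gcongr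
          _ = (r * (k + 2)) ^ 2 * V * A * (τ ^ 2 * (k + 1) ^ 2 * J) := by ring
          _ ≤ _ := by gcongr
    _ ≤ _ := by
        rw [ENNReal.ofReal_mul (by positivity), ENNReal.ofReal_mul (p := _ * A) (by positivity),
          mul_assoc (ENNReal.ofReal _)]
        exact mul_le_mul_right (ofReal_setIntegral_norm_le_eLpNorm_two hu r) _

end Integrals

section Bubble

open Metric

lemma tsupport_const_mul_comp_smul_subset {g : E3 → ℝ} {r c l : ℝ} (hl : 0 < l)
    (hg : tsupport g ⊆ closedBall 0 r) :
    tsupport (fun x => c * g (l • x)) ⊆ closedBall 0 (l⁻¹ * r) := by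
  refine closure_minimal (fun x hx => ?_) isClosed_closedBall
  have h : l • x ∈ closedBall (0 : E3) r :=
    hg (subset_tsupport _ fun h => hx (by simp [h]))
  rw [mem_closedBall_zero_iff, norm_smul, Real.norm_of_nonneg hl.le] at h
  rw [mem_closedBall_zero_iff, inv_mul_eq_div, le_div_iff₀ hl]
  linarith

lemma contDiff_convR {f g : E3 → ℝ} {r : ℝ} (hf : Continuous f)
    (hg : ContDiff ℝ (⊤ : ℕ∞) g) (hgs : tsupport g ⊆ closedBall 0 r) :
    ContDiff ℝ (⊤ : ℕ∞) (convR f g) :=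
  (hasCompactSupport_of_subset_closedBall hgs).contDiff_convolution_right _
    hf.locallyIntegrable hg

lemma tsupport_convR_subset {f g : E3 → ℝ} {r₁ r₂ : ℝ} (hf : tsupport f ⊆ closedBall 0 r₁)
    (hg : tsupport g ⊆ closedBall 0 r₂) : tsupport (convR f g) ⊆ closedBall 0 (r₁ + r₂) := by
  refine closure_minimal (fun x hx => ?_) isClosed_closedBall
  obtain ⟨y, hy, z, hz, rfl⟩ := Set.mem_add.1 (support_convolution_subset _ hx)
  have h1 := mem_closedBall_zero_iff.1 (hf (subset_tsupport _ hy))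
  have h2 := mem_closedBall_zero_iff.1 (hg (subset_tsupport _ hz))
  exact mem_closedBall_zero_iff.2 ((norm_add_le y z).trans (add_le_add h1 h2))

lemma convR_nonneg {f g : E3 → ℝ} (hf : ∀ x, 0 ≤ f x) (hg : ∀ x, 0 ≤ g x) (x : E3) :
    0 ≤ convR f g x :=
  integral_nonneg fun y => mul_nonneg (hf y) (hg (x - y))

lemma convR_le {f g : E3 → ℝ} {A : ℝ} (hf : ∀ x, 0 ≤ f x) (hfi : ∫ x, f x = 1)
    (hg : ∀ x, 0 ≤ g x) (hgA : ∀ x, g x ≤ A) (x : E3) : convR f g x ≤ A := by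
  have hi : Integrable f := by
    by_contra h
    simp [integral_undef h] at hfi
  calc convR f g x ≤ ∫ y, f y * A :=
        integral_mono_of_nonneg (.of_forall fun y => mul_nonneg (hf y) (hg (x - y)))
          (hi.mul_const A) (.of_forall fun y => mul_le_mul_of_nonneg_left (hgA (x - y)) (hf y))
    _ = A := by rw [integral_mul_const, hfi, one_mul]

lemma integral_rhoeps {ρ : E3 → ℝ} (hρ : ∫ x, ρ x = 1) {ε : ℝ} (hε : 0 < ε) :
    ∫ x, rhoeps ρ ε x = 1 := by
  unfold rhoeps
  rw [integral_const_mul, Measure.integral_comp_inv_smul_of_nonneg volume ρ hε.le, hρ,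
    finrank_euclideanSpace_fin, smul_eq_mul, mul_one, inv_mul_cancel₀ (by positivity)]

lemma integral_bubble (s γ : ℝ) (φ : E3 → ℝ) {n : ℝ} (hn : 0 < n) :
    ∫ x, bubble s γ φ n x = kap γ n * n ^ ((3 : ℝ) / 2 - s) * (∫ x, φ x) / n ^ 3 := by
  unfold bubble
  rw [integral_const_mul, Measure.integral_comp_smul_of_nonneg volume φ n (hR := hn.le),
    finrank_euclideanSpace_fin, smul_eq_mul]
  ring

lemma volume_real_closedBall_div {R n : ℝ} (hR : 0 ≤ R) (hn : 0 < n) :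
    volume.real (closedBall (0 : E3) (R / n)) = volume.real (closedBall (0 : E3) R) / n ^ 3 := by
  rw [Measure.addHaar_real_closedBall' _ _ (by positivity), Measure.addHaar_real_closedBall' _ _ hR,
    finrank_euclideanSpace_fin, div_pow]
  ring

lemma lam_sq {γ n : ℝ} (s : ℝ) (k : ℕ) (hκ : 0 ≤ kap γ n) (hn : 0 ≤ n) :
    lam (k + 2) s γ n ^ 2 = (kap γ n * n ^ ((3 : ℝ) / 2 - s)) ^ (k + 1) := by
  unfold lam
  rw [mul_pow, mul_pow, ← Real.rpow_natCast, ← Real.rpow_natCast (n ^ _) 2, ← Real.rpow_mul hκ,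
    ← Real.rpow_mul hn, ← Real.rpow_natCast (kap γ n), ← Real.rpow_natCast (n ^ _) (k + 1),
    ← Real.rpow_mul hn]
  push_cast
  ring_nf

lemma vE_eq_profile {σ s γ n ε t : ℝ} {ρ φ : E3 → ℝ} (k : ℕ)
    (h : ∀ x, 0 ≤ bubbleE s γ ρ φ n ε x) :
    vE σ (k + 2) s γ ρ φ n ε t = fun x => profile (σ * t) k (bubbleE s γ ρ φ n ε x) := by
  ext x
  have hk : ((k + 2 : ℕ) : ℝ) - 1 = ((k + 1 : ℕ) : ℝ) := by push_cast; ring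
  unfold vE profile
  rw [hk, Real.rpow_natCast, abs_of_nonneg (h x)]
  push_cast
  ring_nf

end Bubble

/-- If `φ ≠ 0`, there are `c > 0` and `N ≥ 2` such that for all `n ≥ N` and
`ε ∈ (0, (100n)⁻¹]`, `‖Δ v_nᵉ(t_n)‖_{L²} ≥ c κ_n ((log n)^{(β-γ)(p-1)})² n^{2-s}`. -/
theorem stmt9
    (σ : ℝ) (hσ : σ = 1 ∨ σ = -1)
    (p : ℕ) (hp_odd : Odd p) (hp : 3 ≤ p)
    (s : ℝ) (hs0 : 0 < s) (hs32 : s < 3 / 2)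
    (γ β : ℝ) (hγ0 : 0 < γ) (hγβ : γ < β) (hβ1 : β < 1)
    (ρ : E3 → ℝ) (hρ_smooth : ContDiff ℝ (⊤ : ℕ∞) ρ) (hρ_supp : HasCompactSupport ρ)
    (hρ_nonneg : ∀ x, 0 ≤ ρ x) (hρ_le : ∀ x, ρ x ≤ 1) (hρ_int : ∫ x, ρ x = 1)
    (φ : E3 → ℝ) (hφ_smooth : ContDiff ℝ (⊤ : ℕ∞) φ)
    (hφ_supp : tsupport φ ⊆ Metric.closedBall 0 1)
    (hφ_nonneg : ∀ x, 0 ≤ φ x) (hφ_le : ∀ x, φ x ≤ 1)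
    (hφ_ne : φ ≠ 0) :
    ∃ c > 0, ∃ N : ℝ, 2 ≤ N ∧ ∀ n : ℝ, N ≤ n → ∀ ε : ℝ, 0 < ε → ε ≤ (100 * n)⁻¹ →
      ENNReal.ofReal (c * kap γ n * (Real.log n ^ ((β - γ) * ((p : ℝ) - 1))) ^ 2 *
          n ^ (2 - s)) ≤
        eLpNorm (lap (vE σ p s γ ρ φ n ε (tinf p s γ β n))) 2 volume := by
  obtain ⟨k, rfl⟩ : ∃ k, p = k + 2 := ⟨p - 2, by omega⟩
  have hφc := hasCompactSupport_of_subset_closedBall hφ_supp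
  set M := ∫ x, φ x with hM
  have hM0 : 0 < M := by
    obtain ⟨x, hx⟩ := Function.ne_iff.1 hφ_ne
    exact hφ_smooth.continuous.integral_pos_of_hasCompactSupport_nonneg_nonzero hφc
      hφ_nonneg hx
  obtain ⟨R₀, hR₀, hρR⟩ : ∃ R₀ : ℝ, 0 < R₀ ∧ tsupport ρ ⊆ Metric.closedBall 0 R₀ :=
    hρ_supp.isCompact.isBounded.subset_closedBall_lt 0 0
  set R := 1 + R₀ with hR
  have hRpos : 0 < R := by positivity
  set W := volume.real (Metric.closedBall (0 : E3) R) with hW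
  have hW0 : 0 < W :=
    ENNReal.toReal_pos (Metric.measure_closedBall_pos _ _ hRpos).ne' measure_closedBall_lt_top.ne
  set b := M / (2 * W) with hb
  have hb0 : 0 < b := by positivity
  refine ⟨(k + 1) ^ 2 * (b ^ (k + 1)) ^ 2 * M ^ 2 / 4 / (R ^ 2 * (k + 2) ^ 2 * W * √W),
    by positivity, 2, le_rfl, fun n hn ε hε hεn => ?_⟩
  have hn0 : 0 < n := by linarith
  have hlog : 0 < Real.log n := Real.log_pos (by linarith)
  have hκ : 0 < kap γ n := Real.rpow_pos_of_pos hlog _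
  set P := n ^ ((3 : ℝ) / 2 - s) with hP
  have hP0 : 0 < P := Real.rpow_pos_of_pos hn0 _
  set A := kap γ n * P with hA
  have hA0 : 0 < A := by positivity
  set Λ := Real.log n ^ ((β - γ) * (((k + 2 : ℕ) : ℝ) - 1)) with hΛ
  have hbub : ContDiff ℝ (⊤ : ℕ∞) (bubble s γ φ n) := by unfold bubble; fun_prop
  have hbub_supp : tsupport (bubble s γ φ n) ⊆ Metric.closedBall 0 (n⁻¹ * 1) :=
    tsupport_const_mul_comp_smul_subset hn0 hφ_supp
  have hbub0 : ∀ x, 0 ≤ bubble s γ φ n x := fun x => mul_nonneg hA0.le (hφ_nonneg _)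
  have hbubA : ∀ x, bubble s γ φ n x ≤ A := fun x => mul_le_of_le_one_right hA0.le (hφ_le _)
  have hrho : Continuous (rhoeps ρ ε) := by
    have := hρ_smooth.continuous
    unfold rhoeps
    fun_prop
  have hrho_supp : tsupport (rhoeps ρ ε) ⊆ Metric.closedBall 0 (ε⁻¹⁻¹ * R₀) :=
    tsupport_const_mul_comp_smul_subset (inv_pos.2 hε) hρR
  have hrho0 : ∀ x, 0 ≤ rhoeps ρ ε x := fun x => mul_nonneg (by positivity) (hρ_nonneg _)
  have hrho1 := integral_rhoeps hρ_int hε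
  set f := bubbleE s γ ρ φ n ε with hf
  have hf_smooth : ContDiff ℝ (⊤ : ℕ∞) f := contDiff_convR hrho hbub hbub_supp
  have hf0 : ∀ x, 0 ≤ f x := convR_nonneg hrho0 hbub0
  have hfA : ∀ x, f x ≤ A := convR_le hrho0 hrho1 hbub0 hbubA
  have hf_supp : tsupport f ⊆ Metric.closedBall 0 (R / n) := by
    refine (tsupport_convR_subset hrho_supp hbub_supp).trans (Metric.closedBall_subset_closedBall ?_)
    have : ε ≤ n⁻¹ := hεn.trans (inv_anti₀ hn0 (by linarith))
    rw [inv_inv, hR, add_div, div_eq_mul_inv R₀, mul_one, one_div, add_comm, mul_comm ε]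
    gcongr
  have hf_int : ∫ x, f x = A * M / n ^ 3 := by
    have h1 : ∫ x, f x = (∫ x, rhoeps ρ ε x) • ∫ x, bubble s γ φ n x :=
      integral_convolution _
        (hrho.integrable_of_hasCompactSupport (hasCompactSupport_of_subset_closedBall hrho_supp))
        (hbub.continuous.integrable_of_hasCompactSupport
          (hasCompactSupport_of_subset_closedBall hbub_supp))
    rw [h1, hrho1, one_smul, integral_bubble s γ φ hn0]
  have hvol := volume_real_closedBall_div hRpos.le hn0
  have habV : A * b * (W / n ^ 3) = A * M / n ^ 3 / 2 := by
    rw [hb]; field_simp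
  have key := le_mul_eLpNorm_lap_profile (a := A * b) (σ * tinf (k + 2) s γ β n) k hf_smooth
    hf_supp hf0 hfA (by positivity) (by
      rw [hvol, habV, hf_int]
      exact half_le_self (by positivity))
  rw [← vE_eq_profile k hf0, hvol, habV, hf_int] at key
  set C := (R / n * (k + 2)) ^ 2 * (W / n ^ 3) * A * √(W / n ^ 3) with hC
  have hC0 : 0 < C := by positivity
  refine (ENNReal.mul_le_mul_iff_right (a := ENNReal.ofReal C) (by simpa using hC0)
    ENNReal.ofReal_ne_top).1 (le_trans (le_of_eq ?_) key)
  rw [← ENNReal.ofReal_mul hC0.le]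
  congr 1
  have hσ2 : σ ^ 2 = 1 := by rcases hσ with rfl | rfl <;> norm_num
  have hw : 0 < √n := Real.sqrt_pos.2 hn0
  have hnw : n = √n ^ 2 := (Real.sq_sqrt hn0.le).symm
  have hpow : n ^ (2 - s) = P * √n := by
    rw [hP, Real.sqrt_eq_rpow, ← Real.rpow_add hn0]
    ring_nf
  have hsqrt : √(W / n ^ 3) = √W / √n ^ 3 := by
    rw [Real.sqrt_div hW0.le]
    congr 1
    rw [Real.sqrt_eq_iff_eq_sq (by positivity) (by positivity)]
    nth_rewrite 1 [hnw]
    ring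
  have ht : tinf (k + 2) s γ β n = (A ^ (k + 1))⁻¹ * Λ := by
    unfold tinf
    rw [lam_sq s k hκ.le hn0.le]
  have hsW : 0 < √W := Real.sqrt_pos.2 hW0
  rw [hpow, hC, hsqrt, ht, mul_pow σ, hσ2]
  have hκA : kap γ n = A / P := by rw [hA]; field_simp
  have hn3 : n ^ 3 = √n ^ 6 := by nth_rewrite 1 [hnw]; ring
  have hRn : (R / n * (k + 2)) ^ 2 = R ^ 2 * (k + 2) ^ 2 / √n ^ 4 := by
    nth_rewrite 1 [hnw]; ring
  rw [hκA, hn3, hRn, mul_pow A b]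
  clear_value A P Λ b W R M
  field_simp
  ring
end
end
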